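/- Let B : Matrix (Fin n) (Fin m) ℝ be an orientation matrix of a signed graph Σ (every column has exactly two nonzero entries, each ±1, in distinct rows; no two distinct columns have their nonzero entries in the same pair of rows), with adjacency matrix A := D − B * Bᵀ (D the diagonal of B * Bᵀ). Let T_C := Matrix.fromBlocks A B Bᵀ (2•1 − Bᵀ * B) be the adjacency matrix of the combinatorial total graph of Σ. Then T_C is antibalanced if and only if Σ is antibalanced; that is: there exists a diagonal matrix S : Matrix (Fin (n+m)) (Fin (n+m)) ℝ with all diagonal entries ±1 such that S * T_C * S has all entries nonpositive, if and only if there exists a diagonal matrix s : Matrix (Fin n) (Fin n) ℝ with all diagonal entries ±1 such that s * A * s has all entries nonpositive. -/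

import Mathlib

open Matrix

lemma sgn_conj_apply {ι : Type*} [Fintype ι] [DecidableEq ι] (S M : Matrix ι ι ℝ)
    (h : ∀ i j, i ≠ j → S i j = 0) (i j : ι) :
    (S * M * S) i j = S i i * M i j * S j j := by
  rw [Matrix.mul_apply, Finset.sum_eq_single j, Matrix.mul_apply, Finset.sum_eq_single i]
  · intro b _ hb
    rw [h i b hb.symm, zero_mul]
  · simp
  · intro b _ hb
    rw [h b j hb, mul_zero]
  · simp

/-- The combinatorial total graph `T_C(Σ)` is antibalanced if and only if `Σ`
is antibalanced. -/
theorem combinatorial_total_graph_antibalanced_iff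
    (n m : ℕ) (B : Matrix (Fin n) (Fin m) ℝ)
    (hcol : ∀ e : Fin m, ∃ i j : Fin n, i ≠ j ∧
      (B i e = 1 ∨ B i e = -1) ∧ (B j e = 1 ∨ B j e = -1) ∧
      ∀ k : Fin n, k ≠ i → k ≠ j → B k e = 0)
    (hsupp : ∀ e f : Fin m, (∀ i : Fin n, B i e ≠ 0 ↔ B i f ≠ 0) → e = f) :
    let D : Matrix (Fin n) (Fin n) ℝ := Matrix.diagonal fun i => (B * Bᵀ) i i
    let A : Matrix (Fin n) (Fin n) ℝ := D - B * Bᵀ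
    let TC : Matrix (Fin n ⊕ Fin m) (Fin n ⊕ Fin m) ℝ :=
      Matrix.fromBlocks A B Bᵀ ((2 : ℝ) • 1 - Bᵀ * B)
    (∃ S : Matrix (Fin n ⊕ Fin m) (Fin n ⊕ Fin m) ℝ,
      (∀ i j, i ≠ j → S i j = 0) ∧ (∀ i, S i i = 1 ∨ S i i = -1) ∧
      ∀ i j, (S * TC * S) i j ≤ 0) ↔
    (∃ s : Matrix (Fin n) (Fin n) ℝ,
      (∀ i j, i ≠ j → s i j = 0) ∧ (∀ i, s i i = 1 ∨ s i i = -1) ∧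
      ∀ i j, (s * A * s) i j ≤ 0) := by
  intro D A TC
  constructor
  · rintro ⟨S, h0, h1, h2⟩
    refine ⟨Matrix.diagonal fun i => S (Sum.inl i) (Sum.inl i), ?_, ?_, ?_⟩
    · intro i j hij
      exact Matrix.diagonal_apply_ne _ hij
    · intro i
      rw [Matrix.diagonal_apply_eq]
      exact h1 _
    · intro i j
      have h := h2 (Sum.inl i) (Sum.inl j)
      rw [sgn_conj_apply _ _ h0] at h
      rw [sgn_conj_apply _ _ (fun i j hij => Matrix.diagonal_apply_ne _ hij),
        Matrix.diagonal_apply_eq, Matrix.diagonal_apply_eq]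
      exact h
  · rintro ⟨s, h0, h1, h2⟩
    choose p q hpq hp hq hz using hcol
    have hsupp' : ∀ e k, B k e ≠ 0 ↔ k = p e ∨ k = q e := by
      intro e k
      constructor
      · intro h
        by_contra hc
        push Not at hc
        exact h (hz e k hc.1 hc.2)
      · rintro (rfl | rfl)
        · rcases hp e with h | h <;> rw [h] <;> norm_num
        · rcases hq e with h | h <;> rw [h] <;> norm_num
    have key : ∀ e, (B * Bᵀ) (p e) (q e) = B (p e) e * B (q e) e := by
      intro e
      rw [Matrix.mul_apply, Finset.sum_eq_single e]
      · rfl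
      · intro f _ hf
        by_contra hne
        rw [Matrix.transpose_apply] at hne
        have h3 := (hsupp' f _).1 (left_ne_zero_of_mul hne)
        have h4 := (hsupp' f _).1 (right_ne_zero_of_mul hne)
        apply hf
        apply hsupp
        intro k
        rw [hsupp', hsupp']
        have := hpq e
        have := hpq f
        grind
      · simp
    have hA : ∀ e, 0 ≤ (s (p e) (p e) * B (p e) e) * (s (q e) (q e) * B (q e) e) := by
      intro e
      have h := h2 (p e) (q e)
      rw [sgn_conj_apply _ _ h0] at h
      have hAe : A (p e) (q e) = - (B (p e) e * B (q e) e) := by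
        simp only [A, D, Matrix.sub_apply, key e, Matrix.diagonal_apply_ne _ (hpq e)]
        ring
      rw [hAe] at h
      nlinarith
    let t : Fin m → ℝ := fun e => -(s (p e) (p e) * B (p e) e)
    have ht1 : ∀ e, t e = 1 ∨ t e = -1 := by
      intro e
      simp only [t]
      rcases h1 (p e) with h | h <;> rcases hp e with h' | h' <;> rw [h, h'] <;> norm_num
    have ht : ∀ k e, s k k * B k e * t e ≤ 0 := by
      intro k e
      by_cases hkp : k = p e
      · subst hkp
        simp only [t]
        nlinarith [mul_self_nonneg (s (p e) (p e) * B (p e) e)]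
      · by_cases hkq : k = q e
        · subst hkq
          simp only [t]
          nlinarith [hA e]
        · rw [hz e k hkp hkq]
          simp
    have hs2 : ∀ k, s k k * s k k = 1 := by
      intro k
      rcases h1 k with h | h <;> rw [h] <;> norm_num
    have hBB : ∀ e f, t e * (Bᵀ * B) e f * t f =
        ∑ k, (s k k * B k e * t e) * (s k k * B k f * t f) := by
      intro e f
      rw [Matrix.mul_apply, Finset.mul_sum, Finset.sum_mul]
      refine Finset.sum_congr rfl fun k _ => ?_
      rw [Matrix.transpose_apply]
      linear_combination (-(B k e * t e * B k f * t f)) * hs2 k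
    have hdiag : ∀ e, (Bᵀ * B) e e = 2 := by
      intro e
      rw [Matrix.mul_apply, ← Finset.sum_subset (Finset.subset_univ {p e, q e}),
        Finset.sum_pair (hpq e)]
      · simp only [Matrix.transpose_apply]
        rcases hp e with h | h <;> rcases hq e with h' | h' <;> rw [h, h'] <;> norm_num
      · intro k _ hk
        simp only [Finset.mem_insert, Finset.mem_singleton, not_or] at hk
        rw [hz e k hk.1 hk.2, mul_zero]
    have hd0 : ∀ i j, i ≠ j →
        Matrix.diagonal (Sum.elim (fun i => s i i) t) i j = 0 :=
      fun i j hij => Matrix.diagonal_apply_ne _ hij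
    refine ⟨Matrix.diagonal (Sum.elim (fun i => s i i) t), hd0, ?_, ?_⟩
    · rintro (i | e)
      · simpa using h1 i
      · simpa using ht1 e
    · intro i j
      rw [sgn_conj_apply _ _ hd0, Matrix.diagonal_apply_eq, Matrix.diagonal_apply_eq]
      rcases i with i | e <;> rcases j with j | f
      · have h := h2 i j
        rw [sgn_conj_apply _ _ h0] at h
        exact h
      · exact ht i f
      · have h := ht j e
        simp only [TC, Matrix.fromBlocks_apply₂₁, Sum.elim_inl, Sum.elim_inr,
          Matrix.transpose_apply]
        linarith
      · simp only [TC, Matrix.fromBlocks_apply₂₂, Sum.elim_inr, Matrix.sub_apply,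
          Matrix.smul_apply]
        by_cases hef : e = f
        · subst hef
          rw [hdiag, Matrix.one_apply_eq]
          simp
        · rw [Matrix.one_apply_ne hef]
          have h : 0 ≤ t e * (Bᵀ * B) e f * t f := by
            rw [hBB]
            exact Finset.sum_nonneg fun k _ => mul_nonneg_of_nonpos_of_nonpos (ht k e) (ht k f)
          simp only [smul_zero]
          linarith
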